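/- Let q = p^r with p > 3 prime and q > 9887, and let E be an elliptic cubic curve over F_q with j-invariant j(E) = 0 and with an even number of F_q-rational points. If r is even or p ≡ 1 (mod 3), then for every F_q-rational point P of P²(F_q) not lying on E there exist at least seven distinct F_q-rational lines through P each of which intersects E in 3 distinct F_q-rational points. -/

import Mathlib

set_option linter.unusedSectionVars false

namespace NMDS

open WeierstrassCurve

variable {F : Type} [Field F] [Fintype F] [DecidableEq F]

/-- `ψ_i(X,Y)`: `Y^s` if `i = 3s` (`s ≥ 1`), `X·Y^s` if `i = 3s+2` (`s ≥ 0`),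
`X²·Y^s` if `i = 3s+4` (`s ≥ 0`). -/
def psi (i : ℕ) (X Y : F) : F :=
  if i % 3 = 0 then Y ^ (i / 3)
  else if i % 3 = 2 then X * Y ^ (i / 3)
  else X ^ 2 * Y ^ ((i - 4) / 3)

/-- The coordinate vector of `φ_k(P)`: `(1, ψ₂(P), …, ψ_k(P))` for an affine point `P`,
and `(0, …, 0, 1)` for the point at infinity. -/
def phiVec (W : WeierstrassCurve F) (k : ℕ) : W.toAffine.Point → (Fin k → F)
  | .zero => fun j => if (j : ℕ) = k - 1 then 1 else 0
  | .some (x := x) (y := y) _ => fun j => if (j : ℕ) = 0 then 1 else psi ((j : ℕ) + 1) x y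

lemma phiVec_ne_zero (W : WeierstrassCurve F) {k : ℕ} (hk : 0 < k)
    (P : W.toAffine.Point) : phiVec W k P ≠ 0 := by
  cases P with
  | zero =>
    intro h
    have := congrFun h ⟨k - 1, by omega⟩
    simp [phiVec] at this
  | some h' =>
    intro h
    have := congrFun h ⟨0, hk⟩
    simp [phiVec] at this

/-- The image of a rational point of `E` in `P^{k-1}(F_q)` under `φ_k`. -/
noncomputable def phiProj (W : WeierstrassCurve F) {k : ℕ} (hk : 0 < k)
    (P : W.toAffine.Point) : Projectivization F (Fin k → F) :=
  Projectivization.mk F (phiVec W k P) (phiVec_ne_zero W hk P)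

/-- The `k`-elliptic code associated to `E`, relative to an enumeration `e` of the `n`
rational points of `E`: the span of the rows of the `k × n` matrix whose `j`-th column
is `φ_k(P_j)`. -/
def ellipticCode (W : WeierstrassCurve F) (k : ℕ) {n : ℕ}
    (e : Fin n ≃ W.toAffine.Point) : Submodule F (Fin n → F) :=
  Submodule.span F (Set.range fun i : Fin k => fun j : Fin n => phiVec W k (e j) i)

/-- The minimum distance (= minimum weight) of a linear code. -/
noncomputable def minDist {n : ℕ} (C : Submodule F (Fin n → F)) : ℕ :=
  sInf {d | ∃ x ∈ C, x ≠ 0 ∧ hammingNorm x = d}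

/-- The standard inner product with `y` as a linear map. -/
def dotLin {n : ℕ} (y : Fin n → F) : (Fin n → F) →ₗ[F] F where
  toFun x := ∑ i, x i * y i
  map_add' a b := by simp [add_mul, Finset.sum_add_distrib]
  map_smul' c a := by simp [Finset.mul_sum, mul_assoc]

/-- The dual code: all vectors orthogonal to every codeword. -/
def dualCode {n : ℕ} (C : Submodule F (Fin n → F)) : Submodule F (Fin n → F) :=
  ⨅ y ∈ C, LinearMap.ker (dotLin y)

/-- The Singleton defect `s(C) = n - k + 1 - d` of a code of length `n`. -/
noncomputable def singletonDefect {n : ℕ} (C : Submodule F (Fin n → F)) : ℤ :=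
  (n : ℤ) + 1 - Module.finrank F C - minDist C

/-- A code is MDS if its Singleton defect is zero. -/
noncomputable def IsMDS {n : ℕ} (C : Submodule F (Fin n → F)) : Prop :=
  singletonDefect C = 0

/-- A code is near-MDS if both it and its dual have Singleton defect one. -/
noncomputable def IsNMDS {n : ℕ} (C : Submodule F (Fin n → F)) : Prop :=
  singletonDefect C = 1 ∧ singletonDefect (dualCode C) = 1

/-- An `[n,k,d]_q` code `C` is `h`-extendable if there is an `[n+h,k,d+h]_q` code `C'`
whose projection on the first `n` coordinates is `C`. -/
noncomputable def IsHExtendable {n : ℕ} (h : ℕ) (C : Submodule F (Fin n → F)) : Prop :=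
  ∃ C' : Submodule F (Fin (n + h) → F),
    Module.finrank F C' = Module.finrank F C ∧
    minDist C' = minDist C + h ∧
    Submodule.map (LinearMap.funLeft F F (Fin.castAdd h)) C' = C

/-- The point `p` of `P^{k-1}(F_q)` lies on the hyperplane with coefficient vector `a`. -/
def OnHyp {k : ℕ} (a : Fin k → F) (p : Projectivization F (Fin k → F)) : Prop :=
  ∑ i, a i * p.rep i = 0

/-- An `(·; k, k-2)`-set in `P^{k-1}(F_q)`: no `k+1` of its points lie on a common hyperplane,
i.e. every hyperplane contains at most `k` of its points. -/
def IsArcSet (k : ℕ) (S : Set (Projectivization F (Fin k → F))) : Prop :=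
  ∀ a : Fin k → F, a ≠ 0 → Set.ncard {p ∈ S | OnHyp a p} ≤ k

/-- A complete `(·; k, k-2)`-set: maximal with respect to set-theoretical inclusion. -/
def IsCompleteArcSet (k : ℕ) (S : Set (Projectivization F (Fin k → F))) : Prop :=
  IsArcSet k S ∧ ∀ T, IsArcSet k T → S ⊆ T → T = S

/-- Evaluation of the homogeneous cubic of a Weierstrass curve:
`Y²Z + a₁XYZ + a₃YZ² - X³ - a₂X²Z - a₄XZ² - a₆Z³`. -/
def cubicEval {R : Type*} [CommRing R] (W : WeierstrassCurve R) (x y z : R) : R :=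
  y ^ 2 * z + W.a₁ * x * y * z + W.a₃ * y * z ^ 2
    - (x ^ 3 + W.a₂ * x ^ 2 * z + W.a₄ * x * z ^ 2 + W.a₆ * z ^ 3)

/-- The gradient of the homogeneous cubic of a Weierstrass curve. -/
def gradEval {R : Type*} [CommRing R] (W : WeierstrassCurve R) (x y z : R) : Fin 3 → R :=
  ![W.a₁ * y * z - (3 * x ^ 2 + 2 * W.a₂ * x * z + W.a₄ * z ^ 2),
    2 * y * z + W.a₁ * x * z + W.a₃ * z ^ 2,
    y ^ 2 + W.a₁ * x * y + 2 * W.a₃ * y * z - (W.a₂ * x ^ 2 + 2 * W.a₄ * x * z + 3 * W.a₆ * z ^ 2)]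

/-- The point `p` of `P²(F_q)` lies on the plane cubic `E`. -/
def OnCurve (W : WeierstrassCurve F) (p : Projectivization F (Fin 3 → F)) : Prop :=
  cubicEval W (p.rep 0) (p.rep 1) (p.rep 2) = 0

/-- A line of `P²(F_q)`, given by its coefficient vector `l`, is a tangent of `E`:
it touches the curve at some point (over the algebraic closure) with multiplicity at
least two, i.e. it is the tangent line of the cubic at a contact point. -/
def IsTangentLine (W : WeierstrassCurve F) (l : Fin 3 → F) : Prop :=
  ∃ v : Fin 3 → AlgebraicClosure F, v ≠ 0 ∧
    cubicEval (W.baseChange (AlgebraicClosure F)) (v 0) (v 1) (v 2) = 0 ∧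
    (∑ i, algebraMap F (AlgebraicClosure F) (l i) * v i) = 0 ∧
    ∃ t : AlgebraicClosure F, t ≠ 0 ∧
      gradEval (W.baseChange (AlgebraicClosure F)) (v 0) (v 1) (v 2) =
        t • fun i => algebraMap F (AlgebraicClosure F) (l i)

/-- A line of `P²(F_q)` intersects `E` in three distinct `F_q`-rational points. -/
def IsThreeSecant (W : WeierstrassCurve F) (l : Fin 3 → F) : Prop :=
  ∃ u v w : Projectivization F (Fin 3 → F), u ≠ v ∧ u ≠ w ∧ v ≠ w ∧
    OnCurve W u ∧ OnCurve W v ∧ OnCurve W w ∧ OnHyp l u ∧ OnHyp l v ∧ OnHyp l w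


section Stepanov

open Polynomial

variable {K : Type*} [Field K]

/-- The Hasse derivative of order `k` lowers the exponent of a power by at most `k`. -/
lemma pow_sub_dvd_hasseDeriv_pow_mul (f r : K[X]) (N k : ℕ) :
    f ^ (N - k) ∣ hasseDeriv k (f ^ N * r) := by
  induction N generalizing k with
  | zero => simp
  | succ N ih =>
    rw [pow_succ', mul_assoc, hasseDeriv_mul]
    refine Finset.dvd_sum fun ⟨i, j⟩ hij => ?_
    replace hij : i + j = k := Finset.HasAntidiagonal.mem_antidiagonal.1 hij
    dsimp only
    rcases Nat.eq_zero_or_pos i with rfl | hi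
    · rw [hasseDeriv_zero']
      refine (pow_dvd_pow f (show N + 1 - k ≤ N - j + 1 by omega)).trans ?_
      rw [pow_succ']
      exact mul_dvd_mul_left f (ih j)
    · exact ((pow_dvd_pow f (by omega)).trans (ih j)).mul_left _

/-- The quotient of `hasseDeriv k (f ^ N * r)` by `f ^ (N - k)`, as a linear map in `r`. -/
lemma exists_hasseDeriv_quotient {f : K[X]} (hf : f ≠ 0) {N k : ℕ} (hk : k ≤ N) :
    ∃ G : K[X] →ₗ[K] K[X], ∀ r, hasseDeriv k (f ^ N * r) = f ^ (N - k) * G r ∧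
      (G r).natDegree ≤ r.natDegree + k * f.natDegree := by
  choose g hg using fun r => pow_sub_dvd_hasseDeriv_pow_mul f r N k
  have h0 : f ^ (N - k) ≠ 0 := pow_ne_zero _ hf
  refine ⟨⟨⟨g, fun r s => mul_left_cancel₀ h0 ?_⟩, fun c r => mul_left_cancel₀ h0 ?_⟩,
    fun r => ⟨hg r, ?_⟩⟩
  · rw [← hg, mul_add, mul_add, map_add, hg, hg]
  · rw [← hg, mul_smul_comm, map_smul, hg, RingHom.id_apply, mul_smul_comm]
  · change (g r).natDegree ≤ _
    by_cases hgr : g r = 0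
    · simp [hgr]
    have h1 := natDegree_hasseDeriv_le (f ^ N * r) k
    have h2 := natDegree_mul_le (p := f ^ N) (q := r)
    rw [hg r, natDegree_mul h0 hgr, natDegree_pow] at h1
    rw [natDegree_pow] at h2
    obtain ⟨l, rfl⟩ := Nat.exists_eq_add_of_le hk
    rw [Nat.add_sub_cancel_left] at h1
    rw [add_mul] at h2
    omega

/-- A nonzero polynomial vanishing to order `M` on `S` has degree at least `M * #S`. -/
lemma mul_card_le_natDegree {H : K[X]} (hH : H ≠ 0) (S : Finset K) (M : ℕ)
    (h : ∀ x ∈ S, ∀ k < M, (hasseDeriv k H).eval x = 0) : M * S.card ≤ H.natDegree := by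
  have h1 : ∏ x ∈ S, (X - C x) ^ M ∣ H := by
    refine Finset.prod_dvd_of_coprime (fun x _ y _ hxy => ?_) fun x hx => ?_
    · exact (isCoprime_X_sub_C_of_isUnit_sub (sub_ne_zero.2 hxy).isUnit).pow
    · rw [X_sub_C_pow_dvd_iff, ← taylor_apply, X_pow_dvd_iff]
      intro k hk
      rw [taylor_coeff, h x hx k hk]
  have h2 := natDegree_le_of_dvd h1 hH
  rw [natDegree_prod _ _ fun x _ => pow_ne_zero _ (X_sub_C_ne_zero x)] at h2
  simpa [natDegree_pow, mul_comm] using h2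

variable [Fintype K]

/-- Raising to the power `#K` kills the Hasse derivatives of positive order below `#K`. -/
lemma eval_hasseDeriv_mul_pow_card (U V : K[X]) (x : K) {k : ℕ} (hk : k < Fintype.card K) :
    (hasseDeriv k (U * V ^ Fintype.card K)).eval x = (hasseDeriv k U).eval x * V.eval x := by
  obtain ⟨p, hp⟩ := CharP.exists K
  obtain ⟨n, hprime, hn⟩ := FiniteField.card K p
  have := Fact.mk hprime
  have h : X ^ Fintype.card K ∣
      taylor x (U * V ^ Fintype.card K) - taylor x U * C (V.eval x) := by
    have h1 : X ∣ taylor x V - C (V.eval x) := by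
      rw [X_dvd_iff]; simp [taylor_coeff_zero]
    have h2 := pow_dvd_pow_of_dvd h1 (Fintype.card K)
    rw [hn, sub_pow_char_pow, ← hn, ← C_pow, FiniteField.pow_card] at h2
    rw [taylor_mul, taylor_pow, ← mul_sub]
    exact h2.mul_left _
  have h3 := (X_pow_dvd_iff.1 h) k hk
  rw [coeff_sub, coeff_mul_C, sub_eq_zero, taylor_coeff, taylor_coeff] at h3
  exact h3

lemma eq_zero_of_X_sub_C_pow_dvd {f : K[X]} (hd : f.natDegree ≤ 6)
    (hf : ∀ (c : K) (t : K[X]), f ≠ C c * t ^ 2) {a : K} (ha : f.eval a ≠ 0)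
    (hodd : Fintype.card K % 2 = 1) {r s : K[X]}
    (hr : 2 * r.natDegree + 6 < Fintype.card K) (hs : 2 * s.natDegree + 6 < Fintype.card K)
    (h : (X - C a) ^ Fintype.card K ∣ r + s * f ^ (Fintype.card K / 2)) : r = 0 ∧ s = 0 := by
  obtain ⟨p, hp⟩ := CharP.exists K
  obtain ⟨n, hprime, hn⟩ := FiniteField.card K p
  have := Fact.mk hprime
  have hf0 : f ≠ 0 := by rintro rfl; simp at ha
  set q := Fintype.card K with hq
  have h1 : (X - C a) ^ q ∣ f ^ q - C (f.eval a) := by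
    have h0 : (f - C (f.eval a)) ^ q = f ^ q - C (f.eval a) := by
      rw [hn, sub_pow_char_pow, ← hn, ← C_pow, FiniteField.pow_card]
    rw [← h0]
    exact pow_dvd_pow_of_dvd X_sub_C_dvd_sub_C_eval q
  have h2 : (X - C a) ^ q ∣ r ^ 2 * f - s ^ 2 * C (f.eval a) := by
    have h3 := dvd_add (h.mul_right ((r - s * f ^ (q / 2)) * f)) (h1.mul_left (s ^ 2))
    convert h3 using 1
    have : f ^ q = f ^ (q / 2) * f ^ (q / 2) * f := by
      rw [← pow_add, ← pow_succ]; congr 1; omega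
    rw [this]; ring
  have h4 : r ^ 2 * f = s ^ 2 * C (f.eval a) := by
    rw [← sub_eq_zero]
    refine eq_zero_of_dvd_of_natDegree_lt h2 ?_
    rw [natDegree_pow, natDegree_X_sub_C, mul_one]
    refine lt_of_le_of_lt (natDegree_sub_le _ _) (max_lt ?_ ?_)
    · refine lt_of_le_of_lt natDegree_mul_le ?_
      rw [natDegree_pow]; omega
    · refine lt_of_le_of_lt natDegree_mul_le ?_
      rw [natDegree_pow, natDegree_C]; omega
  by_cases hr0 : r = 0
  · subst hr0
    refine ⟨rfl, ?_⟩
    simpa [ha] using h4.symm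
  · exfalso
    have hu : IsUnit (C (f.eval a)) := isUnit_C.2 (isUnit_iff_ne_zero.2 ha)
    have h5 : r ^ 2 ∣ s ^ 2 := by
      rw [← hu.dvd_mul_right, ← h4]; exact dvd_mul_right _ _
    obtain ⟨t, rfl⟩ := (IsIntegrallyClosed.pow_dvd_pow_iff two_ne_zero).1 h5
    refine hf (f.eval a) t (mul_left_cancel₀ (pow_ne_zero 2 hr0) ?_)
    rw [h4]; ring

lemma eq_zero_of_sum_eq_zero {f : K[X]} (hd : f.natDegree ≤ 6)
    (hf : ∀ (c : K) (t : K[X]), f ≠ C c * t ^ 2) {a : K} (ha : f.eval a ≠ 0)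
    (hodd : Fintype.card K % 2 = 1) (J : ℕ) {r s : ℕ → K[X]}
    (hr : ∀ j, 2 * (r j).natDegree + 6 < Fintype.card K)
    (hs : ∀ j, 2 * (s j).natDegree + 6 < Fintype.card K)
    (h : ∑ j ∈ Finset.range J, (r j + s j * f ^ (Fintype.card K / 2)) *
      ((X - C a) ^ j) ^ Fintype.card K = 0) : ∀ j < J, r j = 0 ∧ s j = 0 := by
  induction J generalizing r s with
  | zero => simp
  | succ J ih =>
    have key : ∑ j ∈ Finset.range J, (r (j + 1) + s (j + 1) * f ^ (Fintype.card K / 2)) *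
        ((X - C a) ^ (j + 1)) ^ Fintype.card K = (X - C a) ^ Fintype.card K *
        ∑ j ∈ Finset.range J, (r (j + 1) + s (j + 1) * f ^ (Fintype.card K / 2)) *
        ((X - C a) ^ j) ^ Fintype.card K := by
      rw [Finset.mul_sum]
      exact Finset.sum_congr rfl fun j _ => by rw [pow_succ, mul_pow]; ring
    rw [Finset.sum_range_succ', key, pow_zero, one_pow, mul_one] at h
    have h0 : r 0 = 0 ∧ s 0 = 0 := by
      refine eq_zero_of_X_sub_C_pow_dvd hd hf ha hodd (hr 0) (hs 0) ?_
      rw [eq_neg_of_add_eq_zero_right h]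
      exact (dvd_mul_right _ _).neg_right
    rw [h0.1, h0.2, zero_mul, add_zero, add_zero, mul_eq_zero] at h
    have h1 := ih (fun j => hr (j + 1)) (fun j => hs (j + 1))
      (h.resolve_left (pow_ne_zero _ (X_sub_C_ne_zero a)))
    rintro (_ | j) hj
    · exact h0
    · exact h1 j (by omega)

/-- Stepanov's bound: a polynomial of degree at most `6` that is not a constant times a square
takes non-square values on at most about `37 / 60` of the field. -/
lemma card_pow_eq_neg_one_le {f : K[X]} (hd : f.natDegree ≤ 6)
    (hf : ∀ (c : K) (t : K[X]), f ≠ C c * t ^ 2) (hodd : Fintype.card K % 2 = 1)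
    (hq : 9887 < Fintype.card K) (S : Finset K)
    (hS : ∀ x ∈ S, f.eval x ^ (Fintype.card K / 2) = -1) :
    60 * S.card ≤ 37 * Fintype.card K + 360 := by
  have hf0 : f ≠ 0 := fun h => hf 0 0 (by simp [h])
  obtain ⟨a, ha⟩ : ∃ a, f.eval a ≠ 0 := by
    by_contra! h
    refine hf0 (eq_zero_of_natDegree_lt_card_of_eval_eq_zero f Function.injective_id h ?_)
    omega
  set q := Fintype.card K with hqdef
  obtain ⟨A, hA⟩ : ∃ A, 2 * A + 5 = q := ⟨(q - 5) / 2, by omega⟩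
  choose G₁ hG₁ using fun k : Fin 30 =>
    exists_hasseDeriv_quotient hf0 (N := 30) (k := (k : ℕ)) k.2.le
  choose G₂ hG₂ using fun k : Fin 30 =>
    exists_hasseDeriv_quotient hf0 (N := 30 + q / 2) (k := (k : ℕ)) (by omega)
  have hdeg : ∀ r : degreeLT K A, (r : K[X]).natDegree < A := fun r => by
    by_cases hr : (r : K[X]) = 0
    · rw [hr, natDegree_zero]; omega
    · exact (natDegree_lt_iff_degree_lt hr).2 (mem_degreeLT.1 r.2)
  let φ : Fin 30 → ((Fin 16 → degreeLT K A) × (Fin 16 → degreeLT K A)) →ₗ[K] K[X] := fun k =>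
    ∑ j : Fin 16, LinearMap.mulRight K ((X - C a) ^ (j : ℕ)) ∘ₗ
      (G₁ k ∘ₗ (degreeLT K A).subtype ∘ₗ LinearMap.proj j ∘ₗ LinearMap.fst K _ _ -
        G₂ k ∘ₗ (degreeLT K A).subtype ∘ₗ LinearMap.proj j ∘ₗ LinearMap.snd K _ _)
  have hφ : ∀ k v, φ k v =
      ∑ j : Fin 16, (G₁ k (v.1 j) - G₂ k (v.2 j)) * (X - C a) ^ (j : ℕ) := fun k v => by
    simp [φ]
  have hmem : ∀ k v, φ k v ∈ degreeLT K (A + 190) := fun k v => by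
    rw [hφ]
    refine Submodule.sum_mem _ fun j _ => mem_degreeLT.2 (degree_le_natDegree.trans_lt ?_)
    have h1 := (hG₁ k (v.1 j)).2
    have h2 := (hG₂ k (v.2 j)).2
    have h3 := hdeg (v.1 j)
    have h4 := hdeg (v.2 j)
    have h5 : (k : ℕ) * f.natDegree ≤ 29 * 6 := Nat.mul_le_mul (by omega) hd
    have h6 := natDegree_sub_le (G₁ k (v.1 j)) (G₂ k (v.2 j))
    have h7 := natDegree_mul_le (p := G₁ k (v.1 j) - G₂ k (v.2 j)) (q := (X - C a) ^ (j : ℕ))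
    rw [natDegree_pow, natDegree_X_sub_C] at h7
    rw [Nat.cast_lt]
    omega
  have hfin : ∀ n, Module.finrank K (degreeLT K n) = n := fun n => by
    rw [(degreeLTEquiv K n).finrank_eq, Module.finrank_fin_fun]
  have hfd : ∀ n, Module.Finite K (degreeLT K n) := fun n =>
    Module.Finite.equiv (degreeLTEquiv K n).symm
  have hker := LinearMap.ker_ne_bot_of_finrank_lt
    (f := LinearMap.pi fun k => (φ k).codRestrict (degreeLT K (A + 190)) (hmem k)) (by
      rw [Module.finrank_prod, Module.finrank_pi_fintype, Module.finrank_pi_fintype]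
      simp only [hfin, Finset.sum_const, Finset.card_univ, Fintype.card_fin, smul_eq_mul]
      omega)
  obtain ⟨v, hv, hv0⟩ := (Submodule.ne_bot_iff _).1 hker
  have hφv : ∀ k, φ k v = 0 := fun k => by
    have := congrFun (LinearMap.mem_ker.1 hv) k
    simpa using congrArg Subtype.val this
  let H : K[X] := f ^ 30 * ∑ j : Fin 16,
    ((v.1 j : K[X]) + (v.2 j : K[X]) * f ^ (q / 2)) * ((X - C a) ^ (j : ℕ)) ^ q
  have hH : H ≠ 0 := by
    intro h0
    have hsum := (mul_eq_zero.1 h0).resolve_left (pow_ne_zero _ hf0)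
    let r : ℕ → K[X] := fun j => if h : j < 16 then v.1 ⟨j, h⟩ else 0
    let s : ℕ → K[X] := fun j => if h : j < 16 then v.2 ⟨j, h⟩ else 0
    have hz := eq_zero_of_sum_eq_zero hd hf ha hodd 16 (r := r) (s := s)
      (fun j => by
        by_cases h : j < 16
        · have := hdeg (v.1 ⟨j, h⟩)
          simp only [r, dif_pos h]; omega
        · simp only [r, dif_neg h, natDegree_zero]; omega)
      (fun j => by
        by_cases h : j < 16
        · have := hdeg (v.2 ⟨j, h⟩)
          simp only [s, dif_pos h]; omega
        · simp only [s, dif_neg h, natDegree_zero]; omega)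
      (by
        rw [Finset.sum_range, ← hsum]
        exact Finset.sum_congr rfl fun j _ => by simp [r, s, q])
    refine hv0 (Prod.ext (funext fun j => Subtype.ext ?_) (funext fun j => Subtype.ext ?_))
    · simpa [r] using (hz j j.2).1
    · simpa [s] using (hz j j.2).2
  have hvan : ∀ x ∈ S, ∀ k < 30, (hasseDeriv k H).eval x = 0 := by
    intro x hx k hk
    have hHsum : H = ∑ j : Fin 16, (f ^ 30 * (v.1 j : K[X]) + f ^ (30 + q / 2) * (v.2 j : K[X])) *
        ((X - C a) ^ (j : ℕ)) ^ q := by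
      simp only [H, Finset.mul_sum]
      exact Finset.sum_congr rfl fun j _ => by rw [pow_add]; ring
    have hterm : ∀ j : Fin 16, (hasseDeriv k ((f ^ 30 * (v.1 j : K[X]) +
        f ^ (30 + q / 2) * (v.2 j : K[X])) * ((X - C a) ^ (j : ℕ)) ^ q)).eval x =
        f.eval x ^ (30 - k) *
          ((G₁ ⟨k, hk⟩ (v.1 j) - G₂ ⟨k, hk⟩ (v.2 j)) * (X - C a) ^ (j : ℕ)).eval x := fun j => by
      rw [eval_hasseDeriv_mul_pow_card _ _ _ (by omega), map_add, (hG₁ ⟨k, hk⟩ _).1,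
        (hG₂ ⟨k, hk⟩ _).1]
      have : 30 + q / 2 - k = 30 - k + q / 2 := by omega
      simp only [this, eval_mul, eval_add, eval_sub, eval_pow, pow_add, hS x hx]
      ring
    rw [hHsum, map_sum, eval_finsetSum, Finset.sum_congr rfl fun j _ => hterm j,
      ← Finset.mul_sum, ← eval_finsetSum, ← hφ, hφv, eval_zero, mul_zero]
  have hle := mul_card_le_natDegree hH S 30 hvan
  have hHdeg : H.natDegree ≤ 180 + (A + 3 * (q - 1) + 15 * q) := by
    refine natDegree_mul_le.trans (Nat.add_le_add ?_ (natDegree_sum_le_of_forall_le _ _ ?_))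
    · rw [natDegree_pow]; omega
    · intro j _
      refine natDegree_mul_le.trans (Nat.add_le_add ?_ ?_)
      · refine natDegree_add_le_of_degree_le ((hdeg _).le.trans (by omega)) ?_
        refine natDegree_mul_le.trans (Nat.add_le_add (hdeg _).le ?_)
        rw [natDegree_pow]
        calc q / 2 * f.natDegree ≤ q / 2 * 6 := Nat.mul_le_mul_left _ hd
          _ ≤ 3 * (q - 1) := by omega
      · rw [natDegree_pow, natDegree_pow, natDegree_X_sub_C, mul_one, mul_comm]
        exact Nat.mul_le_mul_right _ (by omega)
  omega

end Stepanov

section Counting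

open Polynomial Finset

/-- The discriminant of the monic cubic `t³ + a t² + b t + c`. -/
def cubicDisc {R : Type*} [CommRing R] (a b c : R) : R :=
  a ^ 2 * b ^ 2 - 4 * b ^ 3 - 4 * a ^ 3 * c + 18 * a * b * c - 27 * c ^ 2

variable {K : Type*} [Field K]

lemma eq_of_roots_of_not_isSquare_cubicDisc {a b c t u : K}
    (ht : t ^ 3 + a * t ^ 2 + b * t + c = 0) (hu : u ^ 3 + a * u ^ 2 + b * u + c = 0)
    (h : ¬ IsSquare (cubicDisc a b c)) : t = u := by
  by_contra htu
  have hb : b = -(t ^ 2 + t * u + u ^ 2 + a * (t + u)) := by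
    have : (t - u) * (t ^ 2 + t * u + u ^ 2 + a * (t + u) + b) = 0 := by
      linear_combination ht - hu
    linear_combination (mul_eq_zero.1 this).resolve_left (sub_ne_zero.2 htu)
  have hc : c = -(t ^ 3 + a * t ^ 2 + b * t) := by linear_combination ht
  refine h ⟨(t - u) * (t + (a + t + u)) * (u + (a + t + u)), ?_⟩
  rw [cubicDisc, hc, hb]
  ring

lemma exists_roots_of_isSquare_cubicDisc (h2 : (2 : K) ≠ 0) {a b c t : K}
    (ht : t ^ 3 + a * t ^ 2 + b * t + c = 0) (h : IsSquare (cubicDisc a b c))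
    (h0 : cubicDisc a b c ≠ 0) :
    ∃ u v, t ≠ u ∧ t ≠ v ∧ u ≠ v ∧ u ^ 3 + a * u ^ 2 + b * u + c = 0 ∧
      v ^ 3 + a * v ^ 2 + b * v + c = 0 := by
  obtain ⟨d, hd⟩ := h
  set e := 3 * t ^ 2 + 2 * a * t + b with he
  set D := (a + t) ^ 2 - 4 * (b + a * t + t ^ 2) with hD
  have hc : c = -(t ^ 3 + a * t ^ 2 + b * t) := by linear_combination ht
  have hdisc : cubicDisc a b c = D * e ^ 2 := by
    rw [cubicDisc, hc, hD, he]; ring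
  have he0 : e ≠ 0 := by rintro h; rw [hdisc, h] at h0; simp at h0
  have hw : D = (d / e) ^ 2 := by
    rw [div_pow, eq_div_iff (pow_ne_zero 2 he0), ← hdisc, hd, sq]
  set w := d / e
  have hw0 : w ≠ 0 := by rintro h; rw [hdisc, hw, h] at h0; simp at h0
  have hroot : ∀ x, x ^ 2 + (a + t) * x + (b + a * t + t ^ 2) = 0 →
      t ≠ x ∧ x ^ 3 + a * x ^ 2 + b * x + c = 0 := by
    refine fun x hx => ⟨?_, ?_⟩
    · rintro rfl
      exact he0 (by rw [he]; linear_combination hx)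
    · rw [hc]; linear_combination (x - t) * hx
  have hquad : ∀ s : K, s ^ 2 = D → ((-(a + t) + s) / 2) ^ 2 + (a + t) * ((-(a + t) + s) / 2) +
      (b + a * t + t ^ 2) = 0 := by
    intro s hs
    rw [hD] at hs
    field_simp
    linear_combination hs
  have h1 := hroot _ (hquad w hw.symm)
  have h3 := hroot _ (hquad (-w) (by rw [hw]; ring))
  refine ⟨_, _, h1.1, h3.1, fun h => ?_, h1.2, h3.2⟩
  field_simp at h
  refine (mul_ne_zero h2 hw0) ?_
  linear_combination h

lemma isSquare_of_mul_sq_eq_sq {c x d : K} (h : c * x ^ 2 = d ^ 2) (hd : d ≠ 0) : IsSquare c := by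
  have hx : x ≠ 0 := by
    rintro rfl
    exact pow_ne_zero 2 hd (by rw [← h]; ring)
  exact ⟨d / x, by field_simp; linear_combination h⟩

variable [Fintype K]

open Classical in
lemma card_not_isSquare_le {f : K[X]} (hd : f.natDegree ≤ 6)
    (hsq : ∀ (c : K) (t : K[X]), f = C c * t ^ 2 → IsSquare c)
    (hchar : ringChar K ≠ 2) (hq : 9887 < Fintype.card K) :
    60 * #{x : K | ¬ IsSquare (f.eval x)} ≤ 37 * Fintype.card K + 360 := by
  by_cases hf : ∀ (c : K) (t : K[X]), f ≠ C c * t ^ 2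
  · refine card_pow_eq_neg_one_le hd hf (FiniteField.odd_card_of_char_ne_two hchar) hq _ ?_
    intro x hx
    replace hx := (mem_filter.1 hx).2
    have hx0 : f.eval x ≠ 0 := fun h => hx (h ▸ IsSquare.zero)
    rw [FiniteField.isSquare_iff hchar hx0] at hx
    exact (FiniteField.pow_dichotomy hchar hx0).resolve_left hx
  · push Not at hf
    obtain ⟨c, t, rfl⟩ := hf
    obtain ⟨d, hd⟩ := hsq c t rfl
    have : #{x : K | ¬ IsSquare ((C c * t ^ 2).eval x)} = 0 := by
      refine card_eq_zero.2 (filter_eq_empty_iff.2 fun x _ h => h ⟨d * t.eval x, ?_⟩)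
      rw [eval_mul, eval_C, eval_pow, hd]; ring
    rw [this]; omega

lemma card_eval_eq_zero_le {f : K[X]} (hf : f ≠ 0) [DecidablePred fun x => f.eval x = 0] :
    #{x : K | f.eval x = 0} ≤ f.natDegree := by
  classical
  refine (card_le_card fun x hx => ?_).trans ((Multiset.toFinset_card_le _).trans (card_roots' f))
  rw [Multiset.mem_toFinset, mem_roots hf]
  exact (mem_filter.1 hx).2

open Classical in
/-- The curve `y² = x³ + B` has at least about `46 / 60 * #K` affine points. -/
lemma le_card_affine_points (B : K) (hchar : ringChar K ≠ 2) (hq : 9887 < Fintype.card K) :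
    46 * Fintype.card K ≤ 60 * #{P : K × K | P.2 ^ 2 = P.1 ^ 3 + B} + 1080 := by
  have hdeg : (X ^ 3 + C B : K[X]).natDegree = 3 := natDegree_X_pow_add_C
  have h0 : (X ^ 3 + C B : K[X]) ≠ 0 := fun h => by simp [h] at hdeg
  have h1 := card_not_isSquare_le (f := X ^ 3 + C B) (by omega) (fun c t h => by
    have h3 := congrArg natDegree h
    rw [hdeg] at h3
    by_cases hc : c = 0
    · exact hc ▸ IsSquare.zero
    · rw [natDegree_C_mul hc, natDegree_pow] at h3
      omega) hchar hq
  have h2 := card_eval_eq_zero_le h0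
  rw [hdeg] at h2
  simp only [eval_add, eval_pow, eval_X, eval_C] at h1 h2
  set T := (univ : Finset K).filter fun x => ¬ (¬ IsSquare (x ^ 3 + B) ∨ x ^ 3 + B = 0) with hT
  have h3 : Fintype.card K ≤
      #T + (#{x : K | ¬ IsSquare (x ^ 3 + B)} + #{x : K | x ^ 3 + B = 0}) := by
    rw [← card_univ, ← card_filter_add_card_filter_not (s := univ)
      (fun x : K => ¬ IsSquare (x ^ 3 + B) ∨ x ^ 3 + B = 0), filter_or, add_comm]
    exact Nat.add_le_add_left (card_union_le _ _) _
  have h4 : 2 * #T ≤ #{P : K × K | P.2 ^ 2 = P.1 ^ 3 + B} := by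
    have hsum : #{P : K × K | P.2 ^ 2 = P.1 ^ 3 + B} = ∑ x, #{y : K | y ^ 2 = x ^ 3 + B} := by
      simp only [card_filter, Fintype.sum_prod_type]
    rw [hsum, mul_comm, ← smul_eq_mul, ← sum_const]
    refine (sum_le_sum fun x hx => ?_).trans (sum_le_univ_sum_of_nonneg fun _ => Nat.zero_le _)
    obtain ⟨hs, hx0⟩ := not_or.1 (mem_filter.1 hx).2
    obtain ⟨y, hy⟩ := not_not.1 hs
    have hy0 : y ≠ 0 := by rintro rfl; exact hx0 (by rw [hy, mul_zero])
    refine one_lt_card.2 ⟨y, ?_, -y, ?_, fun h =>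
      hy0 (Ring.eq_self_iff_eq_zero_of_char_ne_two hchar |>.1 h.symm)⟩
    all_goals simp [hy, sq]
  omega

open Classical in
/-- In a family of monic cubics with many roots in total whose discriminant is a polynomial, at
least seven members have three distinct roots. -/
lemma seven_le_card_three_roots {a b c : K → K} {f : K[X]}
    (hf : ∀ m, f.eval m = cubicDisc (a m) (b m) (c m)) (hd : f.natDegree ≤ 6) (hf0 : f ≠ 0)
    (hsq : ∀ (c : K) (t : K[X]), f = C c * t ^ 2 → IsSquare c)
    (hchar : ringChar K ≠ 2) (hq : 9887 < Fintype.card K)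
    (hN : 46 * Fintype.card K ≤
      60 * #{P : K × K | P.2 ^ 3 + a P.1 * P.2 ^ 2 + b P.1 * P.2 + c P.1 = 0} + 1200) :
    7 ≤ #{m : K | ∃ t u v, t ≠ u ∧ t ≠ v ∧ u ≠ v ∧ t ^ 3 + a m * t ^ 2 + b m * t + c m = 0 ∧
      u ^ 3 + a m * u ^ 2 + b m * u + c m = 0 ∧ v ^ 3 + a m * v ^ 2 + b m * v + c m = 0} := by
  by_contra! hlt
  set G := (univ : Finset K).filter fun m =>
    ∃ t u v, t ≠ u ∧ t ≠ v ∧ u ≠ v ∧ t ^ 3 + a m * t ^ 2 + b m * t + c m = 0 ∧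
      u ^ 3 + a m * u ^ 2 + b m * u + c m = 0 ∧ v ^ 3 + a m * v ^ 2 + b m * v + c m = 0 with hG
  have h2 : (2 : K) ≠ 0 := Ring.two_ne_zero hchar
  have h3 : ∀ m, #{t : K | t ^ 3 + a m * t ^ 2 + b m * t + c m = 0} ≤ 3 := by
    intro m
    have hdeg : (X ^ 3 + C (a m) * X ^ 2 + C (b m) * X + C (c m) : K[X]).natDegree = 3 := by
      compute_degree!
    have h := card_eval_eq_zero_le (f := X ^ 3 + C (a m) * X ^ 2 + C (b m) * X + C (c m))
      (fun h => by simp [h] at hdeg)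
    rw [hdeg] at h
    simpa using h
  have hk : ∀ m, #{t : K | t ^ 3 + a m * t ^ 2 + b m * t + c m = 0} ≤
      (if f.eval m = 0 then 3 else 0) + (if ¬ IsSquare (f.eval m) then 1 else 0) +
        (if m ∈ G then 3 else 0) := by
    intro m
    by_cases h0 : f.eval m = 0
    · rw [if_pos h0]; have := h3 m; omega
    by_cases hs : IsSquare (f.eval m)
    · by_cases hm : m ∈ G
      · rw [if_pos hm]; have := h3 m; omega
      · refine (card_eq_zero.2 (filter_eq_empty_iff.2 fun t _ ht => hm ?_)).trans_le (Nat.zero_le _)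
        rw [hf] at hs h0
        obtain ⟨u, v, h⟩ := exists_roots_of_isSquare_cubicDisc h2 ht hs h0
        exact mem_filter.2 ⟨mem_univ _, t, u, v, h.1, h.2.1, h.2.2.1, ht, h.2.2.2⟩
    · rw [if_pos hs]
      refine (card_le_one.2 fun t ht u hu => ?_).trans (by omega)
      rw [hf] at hs
      exact eq_of_roots_of_not_isSquare_cubicDisc (mem_filter.1 ht).2 (mem_filter.1 hu).2 hs
  have hsum : #{P : K × K | P.2 ^ 3 + a P.1 * P.2 ^ 2 + b P.1 * P.2 + c P.1 = 0} =
      ∑ m, #{t : K | t ^ 3 + a m * t ^ 2 + b m * t + c m = 0} := by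
    simp only [card_filter, Fintype.sum_prod_type]
  have hle := Finset.sum_le_sum fun m (_ : m ∈ (univ : Finset K)) => hk m
  simp only [sum_add_distrib, ← sum_filter, sum_const, smul_eq_mul, filter_mem_eq_inter,
    univ_inter, mul_one, ← hsum] at hle
  have h4 := card_not_isSquare_le hd hsq hchar hq
  have h5 := card_eval_eq_zero_le hf0
  omega

open Classical in
/-- Lines through an affine point `(u, v)` off the curve `y² = x³ + B`. -/
lemma seven_le_card_slopes {u v B s : K} (hs : s ^ 2 = -3) (hB : B ≠ 0)
    (hP : u ^ 3 + B - v ^ 2 ≠ 0) (hchar : ringChar K ≠ 2) (h3 : (3 : K) ≠ 0)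
    (hq : 9887 < Fintype.card K) :
    7 ≤ #{m : K | ∃ t₁ t₂ t₃, t₁ ≠ t₂ ∧ t₁ ≠ t₃ ∧ t₂ ≠ t₃ ∧
      ∀ t ∈ ({t₁, t₂, t₃} : Set K), (v + m * t) ^ 2 = (u + t) ^ 3 + B} := by
  have h2 : (2 : K) ≠ 0 := Ring.two_ne_zero hchar
  have hs0 : s ≠ 0 := by rintro rfl; exact h3 (by linear_combination hs)
  set c₀ := u ^ 3 + B - v ^ 2 with hc₀
  set f : K[X] := cubicDisc (C (3 * u) - X ^ 2) (C (3 * u ^ 2) - C (2 * v) * X) (C c₀) with hf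
  have hf_eval0 : f.eval 0 = (3 * s * (u ^ 3 - c₀)) ^ 2 := by
    simp only [hf, cubicDisc, eval_sub, eval_add, eval_mul, eval_pow, eval_C, eval_X, eval_ofNat]
    linear_combination (-9 * (u ^ 3 - c₀) ^ 2) * hs
  have hf_div : c₀ = u ^ 3 → ∃ g : K[X], f = X ^ 2 * g ∧ g.eval 0 = (6 * s * u * v) ^ 2 := by
    intro h
    refine ⟨C (4 * (v ^ 2 + u ^ 3)) * X ^ 4 - C (12 * u ^ 2 * v) * X ^ 3 -
      C (27 * u ^ 4 + 24 * u * v ^ 2) * X ^ 2 + C (108 * u ^ 3 * v + 32 * v ^ 3) * X -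
      C (108 * u ^ 2 * v ^ 2), ?_, ?_⟩
    · rw [hf, cubicDisc, h]
      simp only [map_mul, map_add, map_pow, map_ofNat]
      ring
    · simp only [eval_sub, eval_add, eval_mul, eval_pow, eval_C, eval_X]
      linear_combination (-36 * u ^ 2 * v ^ 2) * hs
  have huv : c₀ = u ^ 3 → 6 * s * u * v ≠ 0 := by
    intro h
    have hu : u ≠ 0 := by rintro rfl; exact hP (by rw [h]; ring)
    have hv : v ≠ 0 := by rintro rfl; exact hB (by linear_combination -hc₀ + h)
    have h6 : (6 : K) ≠ 0 := by
      have := mul_ne_zero h2 h3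
      norm_num at this ⊢
      exact this
    exact mul_ne_zero (mul_ne_zero (mul_ne_zero h6 hs0) hu) hv
  have hsq : ∀ (c : K) (t : K[X]), f = C c * t ^ 2 → IsSquare c := by
    intro c t h
    by_cases hc : c₀ = u ^ 3
    · obtain ⟨g, hg, hg0⟩ := hf_div hc
      rw [hc, sub_self, mul_zero, h, eval_mul, eval_C, eval_pow] at hf_eval0
      rcases mul_eq_zero.1 (hf_eval0.trans (zero_pow two_ne_zero)) with h0 | h0
      · exact h0 ▸ IsSquare.zero
      obtain ⟨t', rfl⟩ : X ∣ t := by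
        rw [X_dvd_iff, coeff_zero_eq_eval_zero]
        exact pow_eq_zero_iff two_ne_zero |>.1 h0
      have h1 : g = C c * t' ^ 2 := by
        refine mul_left_cancel₀ (pow_ne_zero 2 (X_ne_zero (R := K))) ?_
        rw [← hg, h]; ring
      rw [h1, eval_mul, eval_C, eval_pow] at hg0
      exact isSquare_of_mul_sq_eq_sq hg0 (huv hc)
    · rw [h, eval_mul, eval_C, eval_pow] at hf_eval0
      exact isSquare_of_mul_sq_eq_sq hf_eval0
        (mul_ne_zero (mul_ne_zero h3 hs0) (sub_ne_zero.2 (Ne.symm hc)))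
  have hf0 : f ≠ 0 := by
    intro h
    by_cases hc : c₀ = u ^ 3
    · obtain ⟨g, hg, hg0⟩ := hf_div hc
      have hgz := (mul_eq_zero.1 (hg.symm.trans h)).resolve_left (pow_ne_zero 2 X_ne_zero)
      rw [hgz, eval_zero] at hg0
      exact pow_ne_zero 2 (huv hc) hg0.symm
    · rw [h, eval_zero] at hf_eval0
      exact pow_ne_zero 2 (mul_ne_zero (mul_ne_zero h3 hs0) (sub_ne_zero.2 (Ne.symm hc)))
        hf_eval0.symm
  have hdeg : f.natDegree ≤ 6 := by
    rw [hf, cubicDisc]; compute_degree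
  have key := seven_le_card_three_roots (f := f) (a := fun m => 3 * u - m ^ 2)
    (b := fun m => 3 * u ^ 2 - 2 * v * m) (c := fun _ => c₀)
    (fun m => by simp [hf, cubicDisc]) hdeg hf0 hsq hchar hq ?_
  · refine key.trans (card_le_card fun m hm => ?_)
    obtain ⟨t₁, t₂, t₃, h12, h13, h23, e1, e2, e3⟩ := (mem_filter.1 hm).2
    refine mem_filter.2 ⟨mem_univ _, t₁, t₂, t₃, h12, h13, h23, ?_⟩
    rintro t (rfl | rfl | rfl)
    · linear_combination -e1 + hc₀
    · linear_combination -e2 + hc₀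
    · linear_combination -e3 + hc₀
  · have h1 := le_card_affine_points B hchar hq
    suffices h : #{P : K × K | P.2 ^ 2 = P.1 ^ 3 + B} ≤ #{P : K × K | P.2 ^ 3 +
        (3 * u - P.1 ^ 2) * P.2 ^ 2 + (3 * u ^ 2 - 2 * v * P.1) * P.2 + c₀ = 0} + 2 by omega
    have h4 : #{P : K × K | P.2 ^ 2 = P.1 ^ 3 + B ∧ P.1 = u} ≤ 2 := by
      have h5 : #{y : K | y ^ 2 = u ^ 3 + B} ≤ 2 := by
        have hdeg2 : (X ^ 2 - C (u ^ 3 + B)).natDegree = 2 := natDegree_X_pow_sub_C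
        have := card_eval_eq_zero_le (f := X ^ 2 - C (u ^ 3 + B))
          (fun h => by rw [h, natDegree_zero] at hdeg2; omega)
        rw [hdeg2] at this
        simpa only [eval_sub, eval_pow, eval_X, eval_C, sub_eq_zero] using this
      refine (card_le_card_of_injOn Prod.snd ?_ ?_).trans h5
      · rintro ⟨x, y⟩ h
        simp only [coe_filter, mem_univ, true_and, Set.mem_ofPred_eq] at h ⊢
        rw [← h.2]; exact h.1
      · rintro ⟨x, y⟩ h ⟨x', y'⟩ h' hy
        simp only [coe_filter, mem_univ, true_and, Set.mem_ofPred_eq] at h h' hy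
        rw [h.2, h'.2, hy]
    have h6 : #{P : K × K | P.2 ^ 2 = P.1 ^ 3 + B ∧ ¬ P.1 = u} ≤ #{P : K × K | P.2 ^ 3 +
        (3 * u - P.1 ^ 2) * P.2 ^ 2 + (3 * u ^ 2 - 2 * v * P.1) * P.2 + c₀ = 0} := by
      refine card_le_card_of_injOn (fun P => ((P.2 - v) / (P.1 - u), P.1 - u)) ?_ ?_
      · rintro ⟨x, y⟩ h
        simp only [coe_filter, mem_univ, true_and, Set.mem_ofPred_eq] at h ⊢
        have hxu := sub_ne_zero.2 h.2
        field_simp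
        rw [hc₀]
        linear_combination -h.1
      · rintro ⟨x, y⟩ h ⟨x', y'⟩ h' hy
        simp only [coe_filter, mem_univ, true_and, Set.mem_ofPred_eq, Prod.mk.injEq,
          sub_left_inj] at h h' hy
        obtain ⟨hy, rfl⟩ := hy
        have hxu := sub_ne_zero.2 h.2
        rw [div_left_inj' hxu, sub_left_inj] at hy
        rw [hy]
    rw [← card_filter_add_card_filter_not (s := filter _ univ) (fun P : K × K => P.1 = u),
      filter_filter, filter_filter]
    omega

open Classical in
/-- Parallel lines of slope `v`, that is, lines through a point at infinity off the curve
`y² = x³ + B`. -/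
lemma seven_le_card_intercepts {v B s : K} (hs : s ^ 2 = -3) (hchar : ringChar K ≠ 2)
    (h3 : (3 : K) ≠ 0) (hq : 9887 < Fintype.card K) :
    7 ≤ #{m : K | ∃ t₁ t₂ t₃, t₁ ≠ t₂ ∧ t₁ ≠ t₃ ∧ t₂ ≠ t₃ ∧
      ∀ t ∈ ({t₁, t₂, t₃} : Set K), (m + v * t) ^ 2 = t ^ 3 + B} := by
  have hs0 : s ≠ 0 := by rintro rfl; exact h3 (by linear_combination hs)
  have h27 : (-27 : K) = (3 * s) ^ 2 := by linear_combination -9 * hs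
  have h27' : (-27 : K) ≠ 0 := by rw [h27]; exact pow_ne_zero 2 (mul_ne_zero h3 hs0)
  set f : K[X] := C (-27) * X ^ 4 + C (-4 * v ^ 3) * X ^ 3 + C (54 * B) * X ^ 2 +
    C (36 * v ^ 3 * B) * X + C (4 * v ^ 6 * B - 27 * B ^ 2) with hf
  have hdeg : f.natDegree = 4 := by rw [hf]; compute_degree!; simpa using h27'
  have hlead : f.leadingCoeff = (3 * s) ^ 2 := by
    rw [leadingCoeff, hdeg, ← h27, hf]; compute_degree!
  have key := seven_le_card_three_roots (f := f) (a := fun _ => -v ^ 2)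
    (b := fun m => -2 * v * m) (c := fun m => B - m ^ 2)
    (fun m => by
      simp only [hf, cubicDisc, eval_add, eval_mul, eval_pow, eval_C, eval_X]
      ring) (by omega) (fun h => by simp [h] at hdeg)
    (fun c t h => by
      rw [h, leadingCoeff_mul, leadingCoeff_C, leadingCoeff_pow] at hlead
      exact isSquare_of_mul_sq_eq_sq hlead (mul_ne_zero h3 hs0)) hchar hq ?_
  · refine key.trans (card_le_card fun m hm => ?_)
    obtain ⟨t₁, t₂, t₃, h12, h13, h23, e1, e2, e3⟩ := (mem_filter.1 hm).2
    refine mem_filter.2 ⟨mem_univ _, t₁, t₂, t₃, h12, h13, h23, ?_⟩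
    rintro t (rfl | rfl | rfl)
    · linear_combination -e1
    · linear_combination -e2
    · linear_combination -e3
  · have h1 := le_card_affine_points B hchar hq
    suffices h : #{P : K × K | P.2 ^ 2 = P.1 ^ 3 + B} ≤ #{P : K × K | P.2 ^ 3 +
        -v ^ 2 * P.2 ^ 2 + -2 * v * P.1 * P.2 + (B - P.1 ^ 2) = 0} by omega
    refine card_le_card_of_injOn (fun P => (P.2 - v * P.1, P.1)) ?_ ?_
    · rintro ⟨x, y⟩ h
      simp only [coe_filter, mem_univ, true_and, Set.mem_ofPred_eq] at h ⊢
      linear_combination -h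
    · rintro ⟨x, y⟩ h ⟨x', y'⟩ h' hy
      simp only [Prod.mk.injEq] at hy
      obtain ⟨hy, rfl⟩ := hy
      rw [sub_left_inj] at hy
      rw [hy]

end Counting

section Lines

open Matrix

lemma onHyp_mk (l w : Fin 3 → F) (hw : w ≠ 0) :
    OnHyp l (Projectivization.mk F w hw) ↔ l ⬝ᵥ w = 0 := by
  obtain ⟨a, ha⟩ := Projectivization.exists_smul_eq_mk_rep F w hw
  change l ⬝ᵥ (Projectivization.mk F w hw).rep = 0 ↔ _
  rw [← ha, dotProduct_smul, smul_eq_zero_iff_eq]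

lemma onCurve_mk (W : WeierstrassCurve F) (w : Fin 3 → F) (hw : w ≠ 0) :
    OnCurve W (Projectivization.mk F w hw) ↔ cubicEval W (w 0) (w 1) (w 2) = 0 := by
  obtain ⟨a, ha⟩ := Projectivization.exists_smul_eq_mk_rep F w hw
  have h : cubicEval W ((a • w) 0) ((a • w) 1) ((a • w) 2) =
      (a : F) ^ 3 * cubicEval W (w 0) (w 1) (w 2) := by
    simp only [cubicEval, Pi.smul_apply, Units.smul_def, smul_eq_mul]; ring
  rw [OnCurve, ← ha, h, mul_eq_zero, or_iff_right (pow_ne_zero 3 a.ne_zero)]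

lemma onHyp_rep_mk (l : Fin 3 → F) (hl : l ≠ 0) (P : Projectivization F (Fin 3 → F)) :
    OnHyp (Projectivization.mk F l hl).rep P ↔ OnHyp l P := by
  obtain ⟨a, ha⟩ := Projectivization.exists_smul_eq_mk_rep F l hl
  change _ ⬝ᵥ P.rep = 0 ↔ l ⬝ᵥ P.rep = 0
  rw [← ha, smul_dotProduct, smul_eq_zero_iff_eq]

/-- A line containing three distinct rational points `a + t b` of the curve is a three-secant. -/
lemma isThreeSecant_of_roots (W : WeierstrassCurve F) {l a b : Fin 3 → F}
    (hla : l ⬝ᵥ a = 0) (hlb : l ⬝ᵥ b = 0) (hab : crossProduct a b ≠ 0) {t₁ t₂ t₃ : F}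
    (h12 : t₁ ≠ t₂) (h13 : t₁ ≠ t₃) (h23 : t₂ ≠ t₃)
    (h : ∀ t ∈ ({t₁, t₂, t₃} : Set F),
      cubicEval W (a 0 + t * b 0) (a 1 + t * b 1) (a 2 + t * b 2) = 0) :
    IsThreeSecant W l := by
  have hcross : ∀ t u : F, crossProduct (a + t • b) (a + u • b) = (u - t) • crossProduct a b := by
    intro t u
    simp only [map_add, map_smul, LinearMap.add_apply, LinearMap.smul_apply, cross_self,
      ← cross_anticomm a b]
    module
  have hne : ∀ t : F, a + t • b ≠ 0 := by
    intro t h0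
    have := hcross t (t + 1)
    rw [h0, map_zero, LinearMap.zero_apply, add_sub_cancel_left, one_smul] at this
    exact hab this.symm
  have hinj : ∀ t u : F, t ≠ u →
      Projectivization.mk F _ (hne t) ≠ Projectivization.mk F _ (hne u) := by
    intro t u htu heq
    obtain ⟨c, hc⟩ := (Projectivization.mk_eq_mk_iff' F _ _ _ _).1 heq
    have := hcross t u
    rw [← hc, map_smul, LinearMap.smul_apply, cross_self, smul_zero] at this
    exact smul_ne_zero (sub_ne_zero.2 htu.symm) hab this.symm
  have hl : ∀ t : F, OnHyp l (Projectivization.mk F _ (hne t)) := fun t => by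
    rw [onHyp_mk, dotProduct_add, dotProduct_smul, hla, hlb, smul_zero, add_zero]
  have hc : ∀ t ∈ ({t₁, t₂, t₃} : Set F), OnCurve W (Projectivization.mk F _ (hne t)) :=
    fun t ht => (onCurve_mk W _ _).2 (h t ht)
  exact ⟨_, _, _, hinj _ _ h12, hinj _ _ h13, hinj _ _ h23, hc _ (by simp), hc _ (by simp),
    hc _ (by simp), hl _, hl _, hl _⟩

/-- Seven three-secants in a pencil of lines `p × d m` through `p`. -/
lemma seven_le_ncard_lines (W : WeierstrassCurve F) {p : Fin 3 → F} (hp : p ≠ 0)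
    {d : F → Fin 3 → F} {κ : F} (hκ : κ ≠ 0)
    (hdet : ∀ m m', crossProduct p (d m) ⬝ᵥ d m' = κ * (m' - m)) {G : Finset F}
    (hG : 7 ≤ G.card) (h : ∀ m ∈ G, IsThreeSecant W (crossProduct p (d m))) :
    7 ≤ Set.ncard {L : Projectivization F (Fin 3 → F) |
      OnHyp L.rep (Projectivization.mk F p hp) ∧ IsThreeSecant W L.rep} := by
  classical
  have hne : ∀ m, crossProduct p (d m) ≠ 0 := by
    intro m h0
    have := hdet m (m + 1)
    rw [h0, zero_dotProduct, add_sub_cancel_left, mul_one] at this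
    exact hκ this.symm
  let L : F → Projectivization F (Fin 3 → F) := fun m => Projectivization.mk F _ (hne m)
  have hL : Function.Injective L := by
    intro m m' heq
    obtain ⟨c, hc⟩ := (Projectivization.mk_eq_mk_iff' F _ _ _ _).1 heq
    have := hdet m m'
    rw [← hc, smul_dotProduct, hdet, sub_self, mul_zero, smul_zero] at this
    exact (sub_eq_zero.1 ((mul_eq_zero.1 this.symm).resolve_left hκ)).symm
  rw [← Finset.card_image_of_injective G hL, ← Set.ncard_coe_finset] at hG
  refine hG.trans (Set.ncard_le_ncard ?_ (Set.toFinite _))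
  intro x hx
  obtain ⟨m, hm, rfl⟩ := Finset.mem_image.1 (Finset.mem_coe.1 hx)
  refine ⟨?_, ?_⟩
  · rw [onHyp_rep_mk, onHyp_mk, dotProduct_comm, dot_self_cross]
  · simpa only [IsThreeSecant, L, onHyp_rep_mk] using h m hm

lemma isSquare_neg_three {K : Type*} [Field K] [Fintype K] (h : Fintype.card K % 3 = 1) :
    ∃ s : K, s ^ 2 = -3 := by
  classical
  have := Fact.mk Nat.prime_three
  have hdvd : 3 ∣ Fintype.card Kˣ := by
    rw [Fintype.card_units]; omega
  obtain ⟨w, hw⟩ := exists_prime_orderOf_dvd_card 3 hdvd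
  have h3 : (w : K) ^ 3 = 1 := by
    rw [← Units.val_pow_eq_pow_val, ← hw, pow_orderOf_eq_one, Units.val_one]
  have h1 : (w : K) - 1 ≠ 0 := by
    intro h0
    have : w = 1 := Units.ext (sub_eq_zero.1 h0)
    rw [this, orderOf_one] at hw
    omega
  have h2 : (w : K) ^ 2 + w + 1 = 0 := by
    refine (mul_eq_zero.1 (?_ : ((w : K) - 1) * _ = 0)).resolve_left h1
    linear_combination h3
  exact ⟨2 * w + 1, by linear_combination 4 * h2⟩

/-- In characteristic different from `2` and `3`, a curve with `c₄ = 0` is projectively equivalent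
to `y² = x³ + B`. -/
lemma neg_mul_cubicEval {K : Type*} [Field K] (W : WeierstrassCurve K) {s : K} (hs : s ^ 2 = -3)
    (hc₄ : W.c₄ = 0) (x y z : K) :
    -1728 * cubicEval W x y z = (12 * s * (2 * y + W.a₁ * x + W.a₃ * z)) ^ 2 * z -
      (-(12 * x + W.b₂ * z)) ^ 3 - (W.b₂ ^ 3 - 432 * W.b₆) * z ^ 3 := by
  rw [cubicEval]
  rw [WeierstrassCurve.c₄] at hc₄
  simp only [WeierstrassCurve.b₂, WeierstrassCurve.b₄, WeierstrassCurve.b₆] at hc₄ ⊢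
  linear_combination (-144 * (2 * y + W.a₁ * x + W.a₃ * z) ^ 2 * z) * hs - 36 * x * z ^ 2 * hc₄

/-- Seven three-secants through an affine point off the curve. -/
lemma seven_le_ncard_lines_affine (W : WeierstrassCurve F) {s e : F} (hs : s ^ 2 = -3)
    (he : 24 * s * e = 1) (hc₄ : W.c₄ = 0) (hB : W.b₂ ^ 3 - 432 * W.b₆ ≠ 0)
    (hchar : ringChar F ≠ 2) (h3 : (3 : F) ≠ 0) (hq : 9887 < Fintype.card F) {x y : F}
    (hxy : cubicEval W x y 1 ≠ 0) (hp : ![x, y, 1] ≠ 0) :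
    7 ≤ Set.ncard {L : Projectivization F (Fin 3 → F) |
      OnHyp L.rep (Projectivization.mk F ![x, y, 1] hp) ∧ IsThreeSecant W L.rep} := by
  have h2 : (2 : F) ≠ 0 := Ring.two_ne_zero hchar
  have h1728 : (-1728 : F) ≠ 0 := by
    rw [show (-1728 : F) = -(2 ^ 6 * 3 ^ 3) by norm_num]
    exact neg_ne_zero.2 (mul_ne_zero (pow_ne_zero 6 h2) (pow_ne_zero 3 h3))
  have hse : s * e ≠ 0 := by
    intro h
    exact one_ne_zero (α := F) (by linear_combination 24 * h - he)
  have he0 : e ≠ 0 := right_ne_zero_of_mul hse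
  have hκ : -2 * (s * e) * e ≠ 0 := mul_ne_zero (mul_ne_zero (neg_ne_zero.2 h2) hse) he0
  have hcubic := neg_mul_cubicEval W hs hc₄
  have hdet : ∀ m m' : F, crossProduct ![x, y, 1] ![-2 * (s * e), (m + W.a₁ * s) * e, 0] ⬝ᵥ
      ![-2 * (s * e), (m' + W.a₁ * s) * e, 0] = -2 * (s * e) * e * (m' - m) := by
    intro m m'
    simp [cross_apply]
    ring
  have hP : (-(12 * x + W.b₂)) ^ 3 + (W.b₂ ^ 3 - 432 * W.b₆) -
      (12 * s * (2 * y + W.a₁ * x + W.a₃)) ^ 2 ≠ 0 := by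
    intro h
    have h1 := hcubic x y 1
    simp only [mul_one, one_pow] at h1
    exact mul_ne_zero h1728 hxy (by linear_combination h1 - h)
  have hG := seven_le_card_slopes hs hB hP hchar h3 hq
  refine seven_le_ncard_lines W hp hκ hdet hG fun m hm => ?_
  simp only [Finset.mem_filter, Finset.mem_univ, true_and] at hm
  obtain ⟨t₁, t₂, t₃, h12, h13, h23, ht⟩ := hm
  refine isThreeSecant_of_roots W (a := ![x, y, 1])
    (b := ![-2 * (s * e), (m + W.a₁ * s) * e, 0]) (by rw [dotProduct_comm, dot_self_cross])
    (by rw [dotProduct_comm, dot_cross_self]) ?_ h12 h13 h23 fun t h => ?_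
  · intro h0
    have := hdet m (m + 1)
    rw [h0, zero_dotProduct, add_sub_cancel_left, mul_one] at this
    exact hκ this.symm
  · refine (mul_eq_zero.1 ((hcubic _ _ _).trans ?_)).resolve_left h1728
    have hX : -(12 * (x + t * (-2 * (s * e))) + W.b₂) = -(12 * x + W.b₂) + t := by
      linear_combination t * he
    have hY : 12 * s * (2 * (y + t * ((m + W.a₁ * s) * e)) +
        W.a₁ * (x + t * (-2 * (s * e))) + W.a₃) =
        12 * s * (2 * y + W.a₁ * x + W.a₃) + m * t := by
      linear_combination t * m * he
    simp only [cons_val_zero, cons_val_one, cons_val, mul_zero, add_zero, mul_one, one_pow]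
    rw [hX, hY]
    linear_combination ht t h

/-- Seven three-secants through a point at infinity off the curve. -/
lemma seven_le_ncard_lines_infinity (W : WeierstrassCurve F) {s e : F} (hs : s ^ 2 = -3)
    (he : 24 * s * e = 1) (hc₄ : W.c₄ = 0) (hchar : ringChar F ≠ 2) (h3 : (3 : F) ≠ 0)
    (hq : 9887 < Fintype.card F) {y : F} (hp : ![-2 * (s * e), y, 0] ≠ 0) :
    7 ≤ Set.ncard {L : Projectivization F (Fin 3 → F) |
      OnHyp L.rep (Projectivization.mk F ![-2 * (s * e), y, 0] hp) ∧ IsThreeSecant W L.rep} := by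
  have h2 : (2 : F) ≠ 0 := Ring.two_ne_zero hchar
  have h1728 : (-1728 : F) ≠ 0 := by
    rw [show (-1728 : F) = -(2 ^ 6 * 3 ^ 3) by norm_num]
    exact neg_ne_zero.2 (mul_ne_zero (pow_ne_zero 6 h2) (pow_ne_zero 3 h3))
  have hse : s * e ≠ 0 := by
    intro h
    exact one_ne_zero (α := F) (by linear_combination 24 * h - he)
  have he0 : e ≠ 0 := right_ne_zero_of_mul hse
  have hκ : 2 * (s * e) * e ≠ 0 := mul_ne_zero (mul_ne_zero h2 hse) he0
  have hcubic := neg_mul_cubicEval W hs hc₄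
  let d : F → Fin 3 → F := fun m =>
    ![-2 * (s * e) * W.b₂, e * m + s * e * (W.a₁ * W.b₂ - 12 * W.a₃), 1]
  have hdet : ∀ m m' : F, crossProduct ![-2 * (s * e), y, 0] (d m) ⬝ᵥ d m' =
      2 * (s * e) * e * (m' - m) := by
    intro m m'
    simp [cross_apply, d]
    ring
  have hG := seven_le_card_intercepts (v := 24 * s * y - W.a₁ * s)
    (B := W.b₂ ^ 3 - 432 * W.b₆) hs hchar h3 hq
  refine seven_le_ncard_lines W hp hκ hdet hG fun m hm => ?_
  simp only [Finset.mem_filter, Finset.mem_univ, true_and] at hm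
  obtain ⟨t₁, t₂, t₃, h12, h13, h23, ht⟩ := hm
  refine isThreeSecant_of_roots W (a := d m) (b := ![-2 * (s * e), y, 0])
    (by rw [dotProduct_comm, dot_cross_self]) (by rw [dotProduct_comm, dot_self_cross])
    ?_ h12 h13 h23 fun t h => ?_
  · intro h0
    have := hdet m (m + 1)
    rw [← cross_anticomm, h0, neg_zero, zero_dotProduct, add_sub_cancel_left, mul_one] at this
    exact hκ this.symm
  · refine (mul_eq_zero.1 ((hcubic _ _ _).trans ?_)).resolve_left h1728
    have hX : -(12 * (-2 * (s * e) * W.b₂ + t * (-2 * (s * e))) + W.b₂) = t := by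
      linear_combination (W.b₂ + t) * he
    have hY : 12 * s * (2 * (e * m + s * e * (W.a₁ * W.b₂ - 12 * W.a₃) + t * y) +
        W.a₁ * (-2 * (s * e) * W.b₂ + t * (-2 * (s * e))) + W.a₃) =
        m + (24 * s * y - W.a₁ * s) * t := by
      linear_combination (m - W.a₁ * s * t - 12 * s * W.a₃) * he
    simp only [d, cons_val_zero, cons_val_one, cons_val, mul_zero, add_zero, mul_one, one_pow]
    rw [hX, hY]
    linear_combination ht t h

end Lines

/-- Let `q = p^r`, `p > 3` prime, `q > 9887`, and let `E` be an elliptic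
cubic over `F_q` with `j(E) = 0` and an even number of `F_q`-rational points. If `r` is even
or `p ≡ 1 (mod 3)`, then through every `F_q`-rational point `P` of `P²(F_q)` not on `E` there
pass at least seven distinct `F_q`-rational lines each meeting `E` in three distinct
`F_q`-rational points. -/
theorem statement7 (p r : ℕ) (hp : p.Prime) (hp3 : 3 < p)
    (hcard : Fintype.card F = p ^ r) (hq : 9887 < Fintype.card F)
    (W : WeierstrassCurve F) [W.IsElliptic] (hj : W.j = 0)
    (heven : Even (Nat.card W.toAffine.Point))
    (hcase : Even r ∨ p % 3 = 1)
    (P : Projectivization F (Fin 3 → F)) (hP : ¬ OnCurve W P) :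
    7 ≤ Set.ncard {L : Projectivization F (Fin 3 → F) |
      OnHyp L.rep P ∧ IsThreeSecant W L.rep} := by
  have := Fact.mk hp
  have : CharP F p := charP_of_card_eq_prime_pow hcard
  have hchar : ringChar F ≠ 2 := by rw [ringChar.eq F p]; omega
  have h2 : (2 : F) ≠ 0 := Ring.two_ne_zero hchar
  have h3 : (3 : F) ≠ 0 := by
    intro h
    have := Nat.le_of_dvd (by norm_num) ((CharP.cast_eq_zero_iff F p 3).1 (by exact_mod_cast h))
    omega
  have hmod : Fintype.card F % 3 = 1 := by
    rw [hcard]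
    rcases hcase with ⟨k, rfl⟩ | h
    · have hp0 : ¬ 3 ∣ p := fun h => by
        have := (Nat.prime_dvd_prime_iff_eq Nat.prime_three hp).1 h
        omega
      have hpp : p ^ 2 % 3 = 1 := by
        rcases (by omega : p % 3 = 1 ∨ p % 3 = 2) with h | h <;> simp [Nat.pow_mod, h]
      rw [← two_mul, pow_mul, Nat.pow_mod, hpp]
      simp
    · simp [Nat.pow_mod, h]
  obtain ⟨s, hs⟩ := isSquare_neg_three hmod
  have hs0 : s ≠ 0 := by rintro rfl; exact h3 (by linear_combination hs)
  have h24 : (24 : F) * s ≠ 0 := by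
    have : (24 : F) = 2 ^ 3 * 3 := by norm_num
    rw [this]
    exact mul_ne_zero (mul_ne_zero (pow_ne_zero 3 h2) h3) hs0
  have h1728 : (1728 : F) ≠ 0 := by
    rw [show (1728 : F) = 2 ^ 6 * 3 ^ 3 by norm_num]
    exact mul_ne_zero (pow_ne_zero 6 h2) (pow_ne_zero 3 h3)
  obtain ⟨e, he⟩ : ∃ e, 24 * s * e = 1 := ⟨(24 * s)⁻¹, mul_inv_cancel₀ h24⟩
  have hc₄ : W.c₄ = 0 := W.j_eq_zero_iff.1 hj
  have hB : W.b₂ ^ 3 - 432 * W.b₆ ≠ 0 := by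
    intro h
    have hc₆ : W.c₆ = 0 := by
      have hrel : 2 * W.c₆ + 3 * W.b₂ * W.c₄ = W.b₂ ^ 3 - 432 * W.b₆ := by
        rw [WeierstrassCurve.c₄, WeierstrassCurve.c₆]
        ring
      rw [h, hc₄, mul_zero, add_zero] at hrel
      exact (mul_eq_zero.1 hrel).resolve_left h2
    have hrel := W.c_relation
    rw [hc₄, hc₆, zero_pow three_ne_zero, zero_pow two_ne_zero, sub_zero] at hrel
    exact mul_ne_zero h1728 W.isUnit_Δ.ne_zero hrel
  obtain ⟨w, hw, rfl⟩ : ∃ w hw, P = Projectivization.mk F w hw := ⟨_, _, P.mk_rep.symm⟩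
  by_cases hz : w 2 = 0
  · have hx : w 0 ≠ 0 := by
      intro hx
      exact hP ((onCurve_mk W w hw).2 (by simp [cubicEval, hx, hz]))
    have hse : -2 * (s * e) ≠ 0 := by
      intro h
      exact one_ne_zero (α := F) (by linear_combination -12 * h - he)
    have hp0 : ![-2 * (s * e), w 1 * (-2 * (s * e)) / w 0, 0] ≠ 0 := fun h =>
      hse (congrFun h 0)
    have hmk : Projectivization.mk F w hw = Projectivization.mk F _ hp0 := by
      rw [Projectivization.mk_eq_mk_iff']
      refine ⟨w 0 / (-2 * (s * e)), ?_⟩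
      ext i
      fin_cases i
      · simpa using div_mul_cancel₀ (w 0) hse
      · change w 0 / (-2 * (s * e)) * (w 1 * (-2 * (s * e)) / w 0) = w 1
        generalize -2 * (s * e) = c at hse
        field_simp
      · simp [hz]
    rw [hmk]
    exact seven_le_ncard_lines_infinity W hs he hc₄ hchar h3 hq hp0
  · have hp0 : ![w 0 / w 2, w 1 / w 2, 1] ≠ 0 := fun h => one_ne_zero (α := F) (congrFun h 2)
    have hmk : Projectivization.mk F w hw = Projectivization.mk F _ hp0 := by
      rw [Projectivization.mk_eq_mk_iff']
      refine ⟨w 2, ?_⟩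
      ext i
      fin_cases i <;> simp [mul_div_cancel₀, hz]
    rw [hmk]
    refine seven_le_ncard_lines_affine W hs he hc₄ hB hchar h3 hq ?_ hp0
    intro h
    exact hP (hmk ▸ (onCurve_mk W _ hp0).2 h)

end NMDS
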